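/- Every involutive Jamesian function J can be written in the form J(a,b) = f⁻¹(f(a) ∗ f(1−b)) for all a, b ∈ (0,1), where f : (0,1) → ℝ is a strictly increasing homeomorphism with f(1−x) = −f(x) for every x ∈ (0,1), and ∗ : ℝ × ℝ → ℝ is a binary operation which is commutative, satisfies x ∗ 0 = x for all x ∈ ℝ, satisfies x ∗ (−x) = 0 for all x ∈ ℝ, has the inverse property (x ∗ t) ∗ (−t) = x for all x, t ∈ ℝ, and is such that for each fixed t ∈ ℝ the map x ↦ x ∗ t is strictly increasing (in particular (ℝ, ∗) is a loop with identity 0 and inverse x ↦ −x). -/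

import Mathlib

open Set

/-- `J` is an involutive Jamesian function on `(0,1)`: it maps
`(0,1) x (0,1)` into `(0,1)`, satisfies the involutive property
`J a (J a b) = b`, satisfies `J a b + J b a = 1`, and for each fixed
`b0 in (0,1)` the map `a => J a b0` is strictly increasing. -/
def IsJamesian (J : ℝ → ℝ → ℝ) : Prop :=
  (∀ a ∈ Set.Ioo (0:ℝ) 1, ∀ b ∈ Set.Ioo (0:ℝ) 1, J a b ∈ Set.Ioo (0:ℝ) 1) ∧
  (∀ a ∈ Set.Ioo (0:ℝ) 1, ∀ b ∈ Set.Ioo (0:ℝ) 1, J a (J a b) = b) ∧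
  (∀ a ∈ Set.Ioo (0:ℝ) 1, ∀ b ∈ Set.Ioo (0:ℝ) 1, J a b + J b a = 1) ∧
  (∀ b₀ ∈ Set.Ioo (0:ℝ) 1, StrictMonoOn (fun a => J a b₀) (Set.Ioo 0 1))

theorem one_sub_mem_Ioo {x : ℝ} (hx : x ∈ Ioo (0 : ℝ) 1) : 1 - x ∈ Ioo (0 : ℝ) 1 :=
  ⟨sub_pos.2 hx.2, sub_lt_self 1 hx.1⟩

namespace IsJamesian

variable {J : ℝ → ℝ → ℝ} {a b : ℝ}

theorem apply_self (hJ : IsJamesian J) (ha : a ∈ Ioo (0 : ℝ) 1) : J a a = 1 / 2 := by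
  linarith [hJ.2.2.1 a ha a ha]

theorem apply_half (hJ : IsJamesian J) (ha : a ∈ Ioo (0 : ℝ) 1) : J a (1 / 2) = a := by
  simpa only [hJ.apply_self ha] using hJ.2.1 a ha a ha

/-- Right inverse property of the operation `(a, b) ↦ J a (1 - b)`. -/
theorem apply_apply_one_sub (hJ : IsJamesian J) (ha : a ∈ Ioo (0 : ℝ) 1)
    (hb : b ∈ Ioo (0 : ℝ) 1) : J (J a b) (1 - b) = a := by
  have hc := hJ.1 a ha b hb
  have h : J (J a b) a = 1 - b := by
    linarith [hJ.2.2.1 _ hc a ha, hJ.2.1 a ha b hb]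
  rw [← h]
  exact hJ.2.1 _ hc a ha

theorem apply_one_sub_comm (hJ : IsJamesian J) (ha : a ∈ Ioo (0 : ℝ) 1)
    (hb : b ∈ Ioo (0 : ℝ) 1) : J a (1 - b) = J b (1 - a) := by
  have hb' := one_sub_mem_Ioo hb
  have hc := hJ.1 a ha _ hb'
  have h : J (J a (1 - b)) b = a := by
    simpa using hJ.apply_apply_one_sub ha hb'
  have h' : J b (J a (1 - b)) = 1 - a := by
    linarith [hJ.2.2.1 _ hc b hb]
  rw [← h']
  exact (hJ.2.1 b hb _ hc).symm

end IsJamesian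

/-- The logit function, inverse on `(0, 1)` to `Real.sigmoid`. -/
noncomputable def logit (x : ℝ) : ℝ := Real.log x - Real.log (1 - x)

theorem logit_one_sub (x : ℝ) : logit (1 - x) = -logit x := by
  simp [logit]

theorem continuousOn_logit : ContinuousOn logit (Ioo 0 1) := by
  unfold logit
  refine (Real.continuousOn_log.mono fun x hx => hx.1.ne').sub
    (ContinuousOn.log (by fun_prop) fun x hx => ?_)
  linarith [hx.2]

theorem strictMonoOn_logit : StrictMonoOn logit (Ioo 0 1) := by
  intro x hx y hy hxy
  have h := Real.log_lt_log hx.1 hxy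
  have h' := Real.log_lt_log (sub_pos.2 hy.2) (sub_lt_sub_left hxy 1)
  unfold logit
  linarith

theorem sigmoid_mem_Ioo (y : ℝ) : Real.sigmoid y ∈ Ioo (0 : ℝ) 1 :=
  ⟨Real.sigmoid_pos y, Real.sigmoid_lt_one y⟩

theorem logit_sigmoid (y : ℝ) : logit (Real.sigmoid y) = y := by
  have h : 0 < 1 + Real.exp (-y) := by positivity
  have h' : 1 - Real.sigmoid y = Real.exp (-y) * (1 + Real.exp (-y))⁻¹ := by
    rw [Real.sigmoid_def]
    field_simp
    ring
  rw [logit, h', Real.sigmoid_def, Real.log_mul (Real.exp_ne_zero _) (inv_ne_zero h.ne'),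
    Real.log_exp]
  ring

theorem sigmoid_logit {x : ℝ} (hx : x ∈ Ioo (0 : ℝ) 1) : Real.sigmoid (logit x) = x :=
  strictMonoOn_logit.injOn (sigmoid_mem_Ioo _) hx (logit_sigmoid _)

/-- every involutive Jamesian function can be written as
`J a b = f⁻¹ (f a * f (1 - b))` where `f : (0,1) → ℝ` is a strictly
increasing homeomorphism with `f (1 - x) = - f x` and `*` is a loop
operation on `ℝ` (commutative, identity `0`, inverse `-x`, inverse property,
strictly increasing translations). -/
theorem stmt_19 (J : ℝ → ℝ → ℝ) (hJ : IsJamesian J) :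
    ∃ f g : ℝ → ℝ, ∃ star : ℝ → ℝ → ℝ,
      ContinuousOn f (Ioo 0 1) ∧
      StrictMonoOn f (Ioo 0 1) ∧
      Continuous g ∧
      (∀ y : ℝ, g y ∈ Ioo (0:ℝ) 1) ∧
      (∀ x ∈ Ioo (0:ℝ) 1, g (f x) = x) ∧
      (∀ y : ℝ, f (g y) = y) ∧
      (∀ x ∈ Ioo (0:ℝ) 1, f (1 - x) = - f x) ∧
      (∀ x y : ℝ, star x y = star y x) ∧
      (∀ x : ℝ, star x 0 = x) ∧
      (∀ x : ℝ, star x (-x) = 0) ∧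
      (∀ x t : ℝ, star (star x t) (-t) = x) ∧
      (∀ t : ℝ, StrictMono (fun x => star x t)) ∧
      (∀ a ∈ Ioo (0:ℝ) 1, ∀ b ∈ Ioo (0:ℝ) 1,
        J a b = g (star (f a) (f (1 - b)))) := by
  refine ⟨logit, Real.sigmoid, fun x y => logit (J (Real.sigmoid x) (1 - Real.sigmoid y)),
    continuousOn_logit, strictMonoOn_logit, by fun_prop, sigmoid_mem_Ioo,
    fun x hx => sigmoid_logit hx, logit_sigmoid, fun x _ => logit_one_sub x,
    fun x y => ?_, fun x => ?_, fun x => ?_, fun x t => ?_, fun t x y hxy => ?_,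
    fun a ha b hb => ?_⟩
  · exact congrArg logit (hJ.apply_one_sub_comm (sigmoid_mem_Ioo x) (sigmoid_mem_Ioo y))
  · have h : (1 : ℝ) - Real.sigmoid 0 = 1 / 2 := by
      rw [Real.sigmoid_zero]
      norm_num
    simp only [h, hJ.apply_half (sigmoid_mem_Ioo x), logit_sigmoid]
  · simp only [Real.sigmoid_neg, sub_sub_cancel, hJ.apply_self (sigmoid_mem_Ioo x)]
    norm_num [logit]
  · have ht := one_sub_mem_Ioo (sigmoid_mem_Ioo t)
    simp only [sigmoid_logit (hJ.1 _ (sigmoid_mem_Ioo x) _ ht), Real.sigmoid_neg,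
      hJ.apply_apply_one_sub (sigmoid_mem_Ioo x) ht, logit_sigmoid]
  · have ht := one_sub_mem_Ioo (sigmoid_mem_Ioo t)
    exact strictMonoOn_logit (hJ.1 _ (sigmoid_mem_Ioo x) _ ht)
      (hJ.1 _ (sigmoid_mem_Ioo y) _ ht)
      (hJ.2.2.2 _ ht (sigmoid_mem_Ioo x) (sigmoid_mem_Ioo y) (Real.sigmoid_strictMono hxy))
  · simp only [sigmoid_logit ha, sigmoid_logit (one_sub_mem_Ioo hb), sub_sub_cancel,
      sigmoid_logit (hJ.1 a ha b hb)]
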